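/- (Partie finie of the integral of a gradient.) Let F ∈ 𝓕 with integer exponents, assume ∂_iF also admits singular expansions at y₁ and y₂, and assume F(x) = o(|x|^{−2}) as |x| → ∞ with ∂_iF integrable near infinity. Then the limit lim_{s→0⁺} [ ∫_{ℝ³∖(B̄(y₁,s) ∪ B̄(y₂,s))} ∂_iF d³x + Σ_{a ≤ −3} s^{a+2} ∫_{S²} nⁱ f_a dΩ + Σ_{b ≤ −3} s^{b+2} ∫_{S²} nⁱ g_b dΩ ] exists and equals −4π (n₁ⁱ r₁² F)₁ − 4π (n₂ⁱ r₂² F)₂ = −∫_{S²} nⁱ f_{−2} dΩ − ∫_{S²} nⁱ g_{−2} dΩ; this is exactly the Hadamard partie finie Pf_{s₁,s₂} ∫ ∂_iF d³x (the logarithmic subtractions vanish, so the result is independent of s₁, s₂). -/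

import Mathlib

open MeasureTheory Filter Topology Real Asymptotics

noncomputable section

abbrev E3 : Type := EuclideanSpace ℝ (Fin 3)
abbrev S2 : Type := Metric.sphere (0 : E3) 1

/-- The surface measure `dΩ` on the unit sphere `S²` (total mass `4π`). -/
def dOmega : Measure S2 := (volume : Measure E3).toSphere

/-- A function on the unit sphere is smooth iff it is the restriction of
a smooth function on `ℝ³`. -/
def SmoothSphereFn (f : S2 → ℝ) : Prop :=
  ∃ g : E3 → ℝ, ContDiff ℝ (⊤ : ℕ∞) g ∧ ∀ n : S2, g (n : E3) = f n

/-- `F` admits a power-like singular expansion at `y` with coefficients `c`: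
the family of exponents (the `a`'s with `c a ≠ 0`) is bounded below, with only
finitely many exponents below any given bound, the coefficients are smooth
functions on the sphere, and for every `N`, `F(y + r n) = Σ_{a ≤ N} r^a (c a)(n)
+ o(r^N)` as `r → 0⁺`, uniformly in `n ∈ S²`. -/
structure HasSingExpansion (y : E3) (F : E3 → ℝ) (c : ℝ → S2 → ℝ) : Prop where
  smooth_coeffs : ∀ a : ℝ, SmoothSphereFn (c a)
  bddBelow : ∃ a₀ : ℝ, ∀ a : ℝ, a < a₀ → c a = 0
  finite_exponents : ∀ N : ℝ, {a : ℝ | a ≤ N ∧ c a ≠ 0}.Finite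
  expansion : ∀ N : ℕ, ∀ ε > 0, ∃ δ > 0, ∀ r : ℝ, 0 < r → r < δ → ∀ n : S2,
    |F (y + r • (n : E3)) - ∑ᶠ (a : ℝ) (_ : a ≤ (N : ℝ)), r ^ a * c a n| ≤ ε * r ^ (N : ℝ)

/-- The exponents of the singular expansion are integers. -/
def IntegerExponents (c : ℝ → S2 → ℝ) : Prop :=
  ∀ a : ℝ, c a ≠ 0 → ∃ k : ℤ, a = (k : ℝ)

/-- The Hadamard partie finie at the singular point, `(F)_y = (1/4π) ∫_{S²} f₀ dΩ`,
expressed in terms of the expansion coefficients `c` of `F`. -/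
def pfAt (c : ℝ → S2 → ℝ) : ℝ :=
  (4 * π)⁻¹ * ∫ n : S2, c 0 n ∂dOmega

/-- `F` is smooth on a punctured neighbourhood of `y`. -/
def SmoothNearPunctured (y : E3) (F : E3 → ℝ) : Prop :=
  ∃ U ∈ 𝓝 y, ContDiffOn ℝ (⊤ : ℕ∞) F (U \ {y})

/-- The quantity whose limit as `s → 0⁺` defines the Hadamard partie finie
`Pf_{s₁,s₂} ∫ F d³x`: the integral over `ℝ³` minus two balls of radius `s`,
plus the divergent subtractions built from the expansion coefficients `c` at `y₁`
and `d` at `y₂`. -/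
def pfApprox (y₁ y₂ : E3) (s₁ s₂ : ℝ) (F : E3 → ℝ) (c d : ℝ → S2 → ℝ) (s : ℝ) : ℝ :=
  (∫ x in (Metric.closedBall y₁ s ∪ Metric.closedBall y₂ s)ᶜ, F x)
    + (∑ᶠ (a : ℝ) (_ : a < -3), s ^ (a + 3) / (a + 3) * ∫ n : S2, c a n ∂dOmega)
    + Real.log (s / s₁) * (∫ n : S2, c (-3) n ∂dOmega)
    + (∑ᶠ (b : ℝ) (_ : b < -3), s ^ (b + 3) / (b + 3) * ∫ n : S2, d b n ∂dOmega)
    + Real.log (s / s₂) * (∫ n : S2, d (-3) n ∂dOmega)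

/-- `Pf_{s₁,s₂} ∫ F d³x` exists and equals `L`. -/
def HasPfIntegral (y₁ y₂ : E3) (s₁ s₂ : ℝ) (F : E3 → ℝ) (c d : ℝ → S2 → ℝ) (L : ℝ) : Prop :=
  Tendsto (pfApprox y₁ y₂ s₁ s₂ F c d) (𝓝[>] (0 : ℝ)) (𝓝 L)

/-- Membership in the class `𝓕`: smooth outside `{y₁, y₂}` and admitting singular
expansions at `y₁` (coefficients `c`) and `y₂` (coefficients `d`). -/
structure MemF (y₁ y₂ : E3) (F : E3 → ℝ) (c d : ℝ → S2 → ℝ) : Prop where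
  smooth : ContDiffOn ℝ (⊤ : ℕ∞) F ({y₁, y₂}ᶜ : Set E3)
  exp₁ : HasSingExpansion y₁ F c
  exp₂ : HasSingExpansion y₂ F d

/-- The partial derivative `∂_i F` (as a plain function, defined outside the
singularities via `fderiv`). -/
def pder (i : Fin 3) (F : E3 → ℝ) (x : E3) : ℝ :=
  fderiv ℝ F x (EuclideanSpace.single i 1)



instance : IsFiniteMeasure dOmega := by unfold dOmega; infer_instance

lemma polar_integral (f : E3 → ℝ) (hf : Integrable f) :
    ∫ x, f x = ∫ r in Set.Ioi (0:ℝ), r ^ 2 * ∫ n : S2, f (r • (n : E3)) ∂dOmega := by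
  have h1 : ∫ x, f x = ∫ x : ({(0 : E3)}ᶜ : Set E3), f x.1 ∂((volume : Measure E3).comap (↑)) := by
    rw [integral_subtype_comap (measurableSet_singleton _).compl f,
        restrict_compl_singleton]
  have hmp := (volume : Measure E3).measurePreserving_homeomorphUnitSphereProd
  have hdim : Module.finrank ℝ E3 - 1 = 2 := by simp
  rw [hdim] at hmp
  have hemb := (homeomorphUnitSphereProd E3).measurableEmbedding
  let g : S2 × Set.Ioi (0:ℝ) → ℝ := fun p => f (p.2.1 • (p.1 : E3))
  have hg : ∀ x : ({(0 : E3)}ᶜ : Set E3), g (homeomorphUnitSphereProd E3 x) = f x.1 := by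
    intro x
    have : ‖x.1‖ ≠ 0 := norm_ne_zero_iff.2 (fun h => x.2 h)
    simp [g, smul_smul, this]
  have h2 : ∫ x : ({(0 : E3)}ᶜ : Set E3), f x.1 ∂((volume : Measure E3).comap (↑))
      = ∫ p, g p ∂((volume : Measure E3).toSphere.prod (Measure.volumeIoiPow 2)) := by
    rw [← hmp.integral_comp hemb]
    simp only [hg]
  have h3 : Integrable g ((volume : Measure E3).toSphere.prod (Measure.volumeIoiPow 2)) := by
    rw [← hmp.integrable_comp_emb hemb]
    have : g ∘ (homeomorphUnitSphereProd E3) = f ∘ Subtype.val := by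
      ext x; exact hg x
    rw [this, ← integrableOn_iff_comap_subtypeVal (measurableSet_singleton _).compl]
    exact hf.integrableOn
  rw [h1, h2, integral_prod_symm _ h3, Measure.volumeIoiPow, 
    integral_withDensity_eq_integral_toReal_smul₀, 
    integral_subtype_comap measurableSet_Ioi
      (fun r : ℝ => (ENNReal.ofReal (r ^ 2)).toReal • ∫ n : S2, f (r • (n : E3)) ∂(volume : Measure E3).toSphere)]
  · refine setIntegral_congr_fun measurableSet_Ioi fun r hr => ?_
    simp only [smul_eq_mul, dOmega]
    rw [ENNReal.toReal_ofReal (by positivity)]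
  · exact (Measurable.ennreal_ofReal (by fun_prop)).aemeasurable
  · exact Eventually.of_forall fun _ => by simp

lemma sphere_smul_ne (r : ℝ) (hr : 0 < r) (n : S2) : r • (n : E3) ∈ ({0}ᶜ : Set E3) := by
  have : (n : E3) ≠ 0 := by
    intro h; have := n.2; simp [h] at this
  simp [this, hr.ne']

lemma sphere_norm_smul (r : ℝ) (hr : 0 < r) (n : S2) : ‖r • (n : E3)‖ = r := by
  have := n.2
  simp [norm_smul] at this ⊢
  exact hr.le

lemma continuousOn_sphInt (u : S2 → ℝ) (hu : Continuous u) (g : E3 → ℝ)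
    (hg : ContinuousOn g {0}ᶜ) :
    ContinuousOn (fun r : ℝ => ∫ n : S2, u n * g (r • (n : E3)) ∂dOmega) (Set.Ioi 0) := by
  rw [continuousOn_iff_continuous_domRestrict]
  have : Continuous (Function.uncurry
      (fun (r : Set.Ioi (0:ℝ)) (n : S2) => u n * g (r.1 • (n : E3)))) := by
    simp only [Function.uncurry_def]
    refine (hu.comp continuous_snd).mul ?_
    exact hg.comp_continuous (by fun_prop) (fun p => sphere_smul_ne _ p.1.2 _)
  have hlc : LocallyCompactSpace (Set.Ioi (0:ℝ)) := isOpen_Ioi.locallyCompactSpace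
  have h := continuous_parametric_integral_of_continuous (μ := dOmega) this isCompact_univ
  simpa [Set.domRestrict_def] using h

lemma continuous_sphere_slice (g : E3 → ℝ)
    (hg : ContinuousOn g {0}ᶜ) (r : ℝ) (hr : 0 < r) : Continuous (fun n : S2 => g (r • (n : E3))) :=
  hg.comp_continuous (by fun_prop) (fun p => sphere_smul_ne _ hr _)

lemma integrable_sphere (u : S2 → ℝ) (hu : Continuous u) : Integrable u dOmega := by
  rw [← integrableOn_univ]; exact hu.continuousOn.integrableOn_compact isCompact_univ

lemma SmoothSphereFn.continuous {f : S2 → ℝ} (h : SmoothSphereFn f) : Continuous f := by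
  obtain ⟨g, hg, h⟩ := h
  have : f = fun n : S2 => g n := by ext n; rw [h]
  rw [this]; exact hg.continuous.comp continuous_subtype_val

/-- integrated expansion -/
lemma expansion_int (F : E3 → ℝ) (c : ℝ → S2 → ℝ) (hc : HasSingExpansion 0 F c)
    (hF : ContinuousOn F {0}ᶜ) (u : S2 → ℝ) (hu : Continuous u) :
    Tendsto (fun r : ℝ => (∫ n : S2, u n * F (r • (n : E3)) ∂dOmega)
      - ∑ a ∈ (hc.finite_exponents 0).toFinset, r ^ a * ∫ n : S2, u n * c a n ∂dOmega)
      (𝓝[>] 0) (𝓝 0) := by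
  set S := (hc.finite_exponents 0).toFinset with hS
  have hsum : ∀ (r : ℝ) (n : S2), ∑ᶠ (a : ℝ) (_ : a ≤ ((0:ℕ) : ℝ)), r ^ a * c a n
      = ∑ a ∈ S, r ^ a * c a n := by
    intro r n
    refine finsum_mem_eq_sum_of_inter_support_eq (s := {a : ℝ | a ≤ ((0:ℕ) : ℝ)}) _ ?_
    ext a
    simp only [hS, Set.mem_inter_iff, Set.mem_ofPred_eq, Function.mem_support, Finset.mem_coe,
      Set.Finite.mem_toFinset, Nat.cast_zero]
    constructor
    · rintro ⟨h1, h2⟩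
      refine ⟨⟨h1, fun h => h2 (by simp [h])⟩, h2⟩
    · rintro ⟨⟨h1, _⟩, h2⟩; exact ⟨h1, h2⟩
  obtain ⟨M, hM⟩ : ∃ M, ∀ n : S2, |u n| ≤ M := by
    obtain ⟨M, hM⟩ := isCompact_univ.exists_bound_of_continuousOn hu.continuousOn
    exact ⟨M, fun n => hM n (Set.mem_univ _)⟩
  rw [Metric.tendsto_nhds]
  intro ε hε
  set V := dOmega.real Set.univ with hV
  have hV0 : 0 ≤ V := measureReal_nonneg
  have hM0 : 0 ≤ |M| := abs_nonneg M
  obtain ⟨δ, hδ, h⟩ := hc.expansion 0 (ε / (|M| * V + 1)) (by positivity)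
  filter_upwards [Ioo_mem_nhdsGT hδ] with r hr
  have hr0 := hr.1
  have h := h r hr.1 hr.2
  have e1 : (∫ n : S2, u n * F (r • (n : E3)) ∂dOmega)
      - ∑ a ∈ S, r ^ a * ∫ n : S2, u n * c a n ∂dOmega
      = ∫ n : S2, u n * (F (r • (n : E3)) - ∑ a ∈ S, r ^ a * c a n) ∂dOmega := by
    simp only [mul_sub, Finset.mul_sum]
    rw [integral_sub, integral_finsetSum]
    · congr 1
      refine Finset.sum_congr rfl fun a _ => ?_
      rw [← integral_const_mul]
      congr 1; ext n; ring
    · intro a _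
      exact integrable_sphere _ (hu.mul (continuous_const.mul (hc.smooth_coeffs a).continuous))
    · exact integrable_sphere _ (hu.mul (continuous_sphere_slice F hF r hr0))
    · exact integrable_sphere _ (continuous_finsetSum _ fun a _ =>
        (hu.mul (continuous_const.mul (hc.smooth_coeffs a).continuous)))
  rw [e1, dist_zero_right]
  have hb : ∀ n : S2, ‖u n * (F (r • (n : E3)) - ∑ a ∈ S, r ^ a * c a n)‖ ≤ |M| * (ε / (|M| * V + 1)) := by
    intro n
    have h := h n
    rw [hsum] at h
    simp only [zero_add, Nat.cast_zero, rpow_zero, mul_one] at h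
    rw [norm_mul]
    exact mul_le_mul ((hM n).trans (le_abs_self M)) h (norm_nonneg _) hM0
  refine (norm_integral_le_of_norm_le_const (Eventually.of_forall hb)).trans_lt ?_
  rw [← hV]
  have : |M| * (ε / (|M| * V + 1)) * V = ε * (|M| * V / (|M| * V + 1)) := by ring
  rw [this]
  have h2 : |M| * V / (|M| * V + 1) < 1 := by
    rw [div_lt_one (by positivity)]; linarith
  nlinarith

lemma matching (S : Finset ℝ) (k : ℝ → ℝ) (κ M : ℝ) (hS : ∀ a ∈ S, a < 0)
    (h : Tendsto (fun s : ℝ => ∑ a ∈ S, k a * s ^ a + κ * Real.log s) (𝓝[>] 0) (𝓝 M)) :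
    κ = 0 ∧ M = 0 := by
  induction S using Finset.induction_on_min with
  | empty =>
    simp only [Finset.sum_empty, zero_add] at h
    have hk : κ = 0 := by
      have h2 := h.mul (tendsto_inv_atBot_zero.comp Real.tendsto_log_nhdsGT_zero)
      rw [mul_zero] at h2
      refine tendsto_nhds_unique (f := fun _ : ℝ => κ) (l := 𝓝[>] (0:ℝ)) tendsto_const_nhds ?_
      refine h2.congr' ?_
      filter_upwards [Ioo_mem_nhdsGT (zero_lt_one)] with s hs
      have : Real.log s ≠ 0 := (Real.log_neg hs.1 hs.2).ne
      simp [this]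
    refine ⟨hk, ?_⟩
    subst hk
    simp only [zero_mul] at h
    exact tendsto_nhds_unique h tendsto_const_nhds
  | insert a S hlt ih =>
    have ha : a < 0 := hS a (Finset.mem_insert_self _ _)
    have haS : a ∉ S := fun h => lt_irrefl _ (hlt a h)
    have hpow : ∀ b : ℝ, 0 < b → Tendsto (fun s : ℝ => s ^ b) (𝓝[>] 0) (𝓝 0) := by
      intro b hb
      have := (Real.continuousAt_rpow_const 0 b (Or.inr hb.le)).tendsto
      rw [Real.zero_rpow hb.ne'] at this
      exact this.mono_left nhdsWithin_le_nhds
    have hka : k a = 0 := by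
      have h2 := (hpow (-a) (by linarith)).mul h
      rw [zero_mul] at h2
      have h3 : Tendsto (fun s : ℝ => ∑ b ∈ S, k b * s ^ (b - a) + κ * (Real.log s * s ^ (-a)))
          (𝓝[>] 0) (𝓝 (∑ b ∈ S, k b * 0 + κ * 0)) := by
        refine Tendsto.add (tendsto_finsetSum _ fun b hb => ?_) ?_
        · exact (hpow _ (by have := hlt b hb; linarith)).const_mul _
        · exact (tendsto_log_mul_rpow_nhdsGT_zero (by linarith)).const_mul _
      simp only [mul_zero, Finset.sum_const_zero, add_zero] at h3
      have h4 := h2.sub h3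
      rw [sub_zero] at h4
      refine tendsto_nhds_unique (f := fun _ : ℝ => k a) (l := 𝓝[>] (0:ℝ)) tendsto_const_nhds ?_
      refine h4.congr' ?_
      filter_upwards [self_mem_nhdsWithin] with s hs
      have hs : 0 < s := hs
      rw [Finset.sum_insert haS, mul_add, mul_add, Finset.mul_sum]
      have e1 : s ^ (-a) * (k a * s ^ a) = k a := by
        rw [mul_left_comm, ← Real.rpow_add hs]; simp
      have e2 : ∑ b ∈ S, s ^ (-a) * (k b * s ^ b) = ∑ b ∈ S, k b * s ^ (b - a) := by
        refine Finset.sum_congr rfl fun b _ => ?_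
        rw [mul_left_comm, ← Real.rpow_add hs]; congr 2; ring
      rw [e1, e2]; ring
    refine ih (fun b hb => hS b (Finset.mem_insert_of_mem hb)) (h.congr fun s => ?_)
    rw [Finset.sum_insert haS, hka, zero_mul, zero_add]


lemma integrableOn_compl_ball (f : E3 → ℝ) (hf : ContinuousOn f {0}ᶜ) (ρ s : ℝ) (hs : 0 < s)
    (h0 : ∀ x, ρ < ‖x‖ → f x = 0) : IntegrableOn f (Metric.ball 0 s)ᶜ := by
  have hK : IsCompact (Metric.closedBall (0:E3) ρ \ Metric.ball 0 s) :=
    IsCompact.diff (isCompact_closedBall _ _) Metric.isOpen_ball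
  have h1 : IntegrableOn f (Metric.closedBall (0:E3) ρ \ Metric.ball 0 s) := by
    refine ContinuousOn.integrableOn_compact hK (hf.mono ?_)
    rintro x ⟨_, hx⟩ rfl
    exact hx (by simpa using hs)
  have h2 : (Metric.ball (0:E3) s)ᶜ ⊆
      (Metric.closedBall (0:E3) ρ \ Metric.ball 0 s) ∪ (Metric.closedBall (0:E3) ρ)ᶜ := by
    intro x hx
    by_cases h : x ∈ Metric.closedBall (0:E3) ρ
    · exact Or.inl ⟨h, hx⟩
    · exact Or.inr h
  refine IntegrableOn.mono_set (h1.union ?_) h2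
  refine IntegrableOn.congr_fun (f := fun _ => (0:ℝ)) integrableOn_zero ?_
    measurableSet_closedBall.compl
  intro x hx
  exact (h0 x (by simpa using hx)).symm

lemma integrable_of_vanish (f : E3 → ℝ) (hf : ContinuousOn f {0}ᶜ) (ρ s : ℝ) (hs : 0 < s)
    (h0 : ∀ x, ρ < ‖x‖ → f x = 0) (h1 : ∀ x, ‖x‖ < s → f x = 0) : Integrable f := by
  have := integrableOn_compl_ball f hf ρ s hs h0
  rwa [integrableOn_iff_integrable_of_support_subset] at this
  intro x hx h
  exact hx (h1 x (by simpa using h))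

lemma integral_pder_eq_zero (i : Fin 3) (H : E3 → ℝ) (hH : Differentiable ℝ H)
    (h1 : Integrable H) (h2 : Integrable (pder i H)) : ∫ x, pder i H x = 0 := by
  have := integral_mul_fderiv_eq_neg_fderiv_mul_of_integrable (μ := (volume : Measure E3))
    (f := fun _ : E3 => (1:ℝ)) (g := H) (v := EuclideanSpace.single i 1)
    (by simp) (by simp only [one_mul]; exact h2) (by simpa using h1)
    (fun x _ => differentiableAt_const _) (fun x _ => hH x)
  simpa [pder] using this

lemma pder_norm (i : Fin 3) (x : E3) (hx : x ≠ 0) :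
    HasFDerivAt (fun x : E3 => ‖x‖) (fderiv ℝ (fun x : E3 => ‖x‖) x) x ∧
    fderiv ℝ (fun x : E3 => ‖x‖) x (EuclideanSpace.single i 1) = x i / ‖x‖ := by
  have h : HasFDerivAt (fun x : E3 => ‖x‖) (fderiv ℝ (fun x : E3 => ‖x‖) x) x :=
    ((contDiffAt_norm ℝ hx (n := 1)).differentiableAt (by simp)).hasFDerivAt
  refine ⟨h, ?_⟩
  have h2 := h.pow 2
  have h3 := (hasStrictFDerivAt_norm_sq x).hasFDerivAt
  have h4 := h2.unique h3
  have h5 := congrArg (fun L => L (EuclideanSpace.single i 1)) h4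
  simp [EuclideanSpace.inner_single_right] at h5
  have : ‖x‖ ≠ 0 := norm_ne_zero_iff.2 hx
  field_simp
  linarith

lemma dT_nonpos (u : ℝ) (hu : u ≤ 0) : deriv smoothTransition u = 0 := by
  refine IsLocalMin.deriv_eq_zero (Eventually.of_forall fun v => ?_)
  rw [smoothTransition.zero_of_nonpos hu]; exact smoothTransition.nonneg v

lemma dT_one_le (u : ℝ) (hu : 1 ≤ u) : deriv smoothTransition u = 0 := by
  refine IsLocalMax.deriv_eq_zero (Eventually.of_forall fun v => ?_)
  rw [smoothTransition.one_of_one_le hu]; exact smoothTransition.le_one v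

lemma dT_cont : Continuous (deriv smoothTransition) :=
  (smoothTransition.contDiff (n := 1)).continuous_deriv (by simp)

lemma T_diff : Differentiable ℝ smoothTransition :=
  (smoothTransition.contDiff (n := 1)).differentiable (by simp)

lemma dT_int : ∫ u in (0:ℝ)..1, deriv smoothTransition u = 1 := by
  rw [intervalIntegral.integral_deriv_eq_sub (fun x _ => T_diff x) (dT_cont.intervalIntegrable _ _)]
  simp

lemma dT_bound : ∃ C, ∀ u, |deriv smoothTransition u| ≤ C := by
  obtain ⟨C, hC⟩ := (isCompact_Icc (a := (0:ℝ)) (b := 1)).exists_bound_of_continuousOn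
    dT_cont.continuousOn
  refine ⟨max C 0, fun u => ?_⟩
  rcases le_total u 0 with h | h
  · rw [dT_nonpos u h]; simp
  rcases le_total 1 u with h' | h'
  · rw [dT_one_le u h']; simp
  · exact (hC u ⟨h, h'⟩).trans (le_max_left _ _)

/-- approximate identity -/
lemma approx_id (φ : ℝ → ℝ) (hφ : ContinuousOn φ (Set.Ioi 0)) (s : ℝ) (hs : 0 < s) :
    Tendsto (fun k : ℕ => ∫ r in Set.Ioi (0:ℝ),
      ((k+1 : ℕ) : ℝ) * deriv smoothTransition (((k+1 : ℕ) : ℝ) * (r - s)) * φ r) atTop (𝓝 (φ s)) := by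
  have key : ∀ k : ℕ, ∫ r in Set.Ioi (0:ℝ),
      ((k+1 : ℕ) : ℝ) * deriv smoothTransition (((k+1 : ℕ) : ℝ) * (r - s)) * φ r
      = ∫ u in (0:ℝ)..1, deriv smoothTransition u * φ (s + ((k+1 : ℕ) : ℝ)⁻¹ * u) := by
    intro k
    set κ : ℝ := ((k+1 : ℕ) : ℝ) with hκ
    have hk : 0 < κ := by positivity
    have hsub : Set.Ioc s (s + κ⁻¹) ⊆ Set.Ioi 0 := fun r hr => hs.trans hr.1
    rw [setIntegral_eq_of_subset_of_forall_sdiff_eq_zero measurableSet_Ioi hsub]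
    · rw [← intervalIntegral.integral_of_le (by linarith [inv_pos.2 hk])]
      have := intervalIntegral.integral_comp_add_mul (a := 0) (b := 1) 
        (fun r => κ * deriv smoothTransition (κ * (r - s)) * φ r) (inv_ne_zero hk.ne') s
      simp only [mul_zero, add_zero, mul_one, inv_inv, smul_eq_mul] at this
      have h3 : ∫ r in s..s+κ⁻¹, κ * deriv smoothTransition (κ * (r - s)) * φ r = 
        κ⁻¹ * ∫ x in (0:ℝ)..1, κ * deriv smoothTransition (κ * (s + κ⁻¹ * x - s)) * φ (s + κ⁻¹ * x) := by
        rw [this]; field_simp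
      rw [h3, ← intervalIntegral.integral_const_mul]
      refine intervalIntegral.integral_congr fun u _ => ?_
      have e : κ * (s + κ⁻¹ * u - s) = u := by field_simp; ring
      simp only [e]
      field_simp
    · rintro r ⟨hr, hr2⟩
      have : deriv smoothTransition (κ * (r - s)) = 0 := by
        rcases le_or_gt r s with h | h
        · exact dT_nonpos _ (mul_nonpos_of_nonneg_of_nonpos hk.le (by linarith))
        · refine dT_one_le _ ?_
          have h4 : s + κ⁻¹ < r := by
            by_contra h5
            exact hr2 ⟨h, not_lt.1 h5⟩
          have : κ * κ⁻¹ ≤ κ * (r - s) := mul_le_mul_of_nonneg_left (by linarith) hk.le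
          rwa [mul_inv_cancel₀ hk.ne'] at this
      simp [this]
  simp only [key]
  have hlim : φ s = ∫ u in (0:ℝ)..1, deriv smoothTransition u * φ s := by
    rw [intervalIntegral.integral_mul_const, dT_int, one_mul]
  rw [hlim]
  obtain ⟨C, hC⟩ := dT_bound
  obtain ⟨B, hB⟩ := (isCompact_Icc (a := s) (b := s+1)).exists_bound_of_continuousOn
    (hφ.mono (fun r hr => hs.trans_le hr.1))
  have hmem : ∀ k : ℕ, ∀ u ∈ Set.Icc (0:ℝ) 1, s + ((k+1 : ℕ) : ℝ)⁻¹ * u ∈ Set.Icc s (s+1) := by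
    intro k u hu
    have h1 : ((k+1 : ℕ) : ℝ)⁻¹ ≤ 1 := by
      apply inv_le_one_of_one_le₀; push_cast; linarith [(Nat.cast_nonneg k : (0:ℝ) ≤ k)]
    have h0 : 0 ≤ ((k+1 : ℕ) : ℝ)⁻¹ := by positivity
    constructor
    · nlinarith [mul_nonneg h0 hu.1]
    · nlinarith [mul_le_one₀ h1 hu.1 hu.2]
  refine intervalIntegral.tendsto_integral_filter_of_dominated_convergence (fun _ => C * B) ?_ ?_ ?_ ?_
  · refine Eventually.of_forall fun k => ?_
    rw [Set.uIoc_of_le zero_le_one]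
    refine ContinuousOn.aestronglyMeasurable ?_ measurableSet_Ioc
    refine dT_cont.continuousOn.mul (hφ.comp (by fun_prop) fun u hu => ?_)
    exact hs.trans_le (hmem k u ⟨hu.1.le, hu.2⟩).1
  · refine Eventually.of_forall fun k => Eventually.of_forall fun u hu => ?_
    rw [Set.uIoc_of_le zero_le_one] at hu
    rw [norm_mul]
    exact mul_le_mul (hC u) (hB _ (hmem k u ⟨hu.1.le, hu.2⟩)) (norm_nonneg _)
      ((abs_nonneg _).trans (hC u))
  · exact intervalIntegrable_const
  · refine Eventually.of_forall fun u hu => ?_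
    refine Tendsto.const_mul _ ?_
    have hc : ContinuousAt φ s := hφ.continuousAt (Ioi_mem_nhds hs)
    refine hc.tendsto.comp ?_
    have h1 : Tendsto (fun k : ℕ => ((k+1 : ℕ) : ℝ)⁻¹) atTop (𝓝 0) :=
      (tendsto_inv_atTop_zero.comp tendsto_natCast_atTop_atTop).comp (tendsto_add_atTop_nat 1)
    have h2 := (h1.mul_const u).const_add s
    simpa using h2

lemma pder_continuousOn (i : Fin 3) (G : E3 → ℝ) (U : Set E3) (hU : IsOpen U)
    (hG : ContDiffOn ℝ (⊤ : ℕ∞) G U) : ContinuousOn (pder i G) U := by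
  have := hG.continuousOn_fderiv_of_isOpen hU (by simp)
  exact this.clm_apply continuousOn_const

lemma pder_zero_of_far (i : Fin 3) (G : E3 → ℝ) (ρ : ℝ) (h0 : ∀ x, ρ < ‖x‖ → G x = 0) :
    ∀ x, ρ < ‖x‖ → pder i G x = 0 := by
  intro x hx
  have : G =ᶠ[𝓝 x] fun _ => 0 := by
    filter_upwards [(isOpen_lt continuous_const continuous_norm).mem_nhds hx] with z hz
    exact h0 z hz
  rw [pder, this.fderiv_eq]; simp

lemma flux (i : Fin 3) (G : E3 → ℝ) (hG : ContDiffOn ℝ (⊤ : ℕ∞) G {0}ᶜ) (ρ : ℝ)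
    (h0 : ∀ x, ρ < ‖x‖ → G x = 0) (s : ℝ) (hs : 0 < s) :
    ∫ x in (Metric.closedBall 0 s)ᶜ, pder i G x
      = - (s ^ 2 * ∫ n : S2, (n : E3) i * G (s • (n : E3)) ∂dOmega) := by
  have hop : IsOpen ({0}ᶜ : Set E3) := isOpen_compl_singleton
  have hdc := pder_continuousOn i G _ hop hG
  have hd0 := pder_zero_of_far i G ρ h0
  have hGc := hG.continuousOn
  let κ : ℕ → ℝ := fun k => ((k+1 : ℕ) : ℝ)
  have hκ : ∀ k, 0 < κ k := fun k => by simp only [κ]; positivity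
  let a : ℕ → E3 → ℝ := fun k x => smoothTransition (κ k * (‖x‖ - s)) * pder i G x
  let b : ℕ → E3 → ℝ := fun k x =>
    κ k * deriv smoothTransition (κ k * (‖x‖ - s)) * (x i / ‖x‖) * G x
  let H : ℕ → E3 → ℝ := fun k x => smoothTransition (κ k * (‖x‖ - s)) * G x
  have hneg : ∀ k (x : E3), ‖x‖ ≤ s → κ k * (‖x‖ - s) ≤ 0 := fun k x hx =>
    mul_nonpos_of_nonneg_of_nonpos (hκ k).le (by linarith)
  have hHz : ∀ k (x : E3), ‖x‖ < s → H k =ᶠ[𝓝 x] fun _ => 0 := by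
    intro k x hx
    filter_upwards [(isOpen_lt continuous_norm continuous_const).mem_nhds hx] with z hz
    simp only [H]
    rw [smoothTransition.zero_of_nonpos (hneg k z (le_of_lt hz)), zero_mul]
  have hHd : ∀ k x, x ≠ 0 → HasFDerivAt (H k) (fderiv ℝ (H k) x) x ∧ pder i (H k) x = a k x + b k x := by
    intro k x hx
    obtain ⟨n1, n2⟩ := pder_norm i x hx
    have hT : HasFDerivAt (fun x : E3 => smoothTransition (κ k * (‖x‖ - s)))
        (deriv smoothTransition (κ k * (‖x‖ - s)) • κ k • fderiv ℝ (fun x : E3 => ‖x‖) x) x :=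
      HasDerivAt.comp_hasFDerivAt (h₂ := smoothTransition) x (T_diff (κ k * (‖x‖ - s))).hasDerivAt ((n1.sub_const s).const_mul (κ k))
    have hGd : HasFDerivAt G (fderiv ℝ G x) x :=
      ((hG.contDiffAt (hop.mem_nhds hx)).differentiableAt (by simp)).hasFDerivAt
    have hm := hT.mul hGd
    have hm' : HasFDerivAt (H k) _ x := hm
    refine ⟨hm'.differentiableAt.hasFDerivAt, ?_⟩
    rw [pder, hm'.fderiv]
    simp only [ContinuousLinearMap.add_apply, ContinuousLinearMap.smul_apply, smul_eq_mul, n2, a, b, pder]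
    ring
  have hpd : ∀ k x, pder i (H k) x = a k x + b k x := by
    intro k x
    by_cases hx : x = 0
    · have hxs : ‖x‖ < s := by simpa [hx] using hs
      rw [pder, (hHz k x hxs).fderiv_eq]
      simp only [a, b]
      rw [smoothTransition.zero_of_nonpos (hneg k x hxs.le), dT_nonpos _ (hneg k x hxs.le)]
      simp
    · exact (hHd k x hx).2
  have hdiff : ∀ k, Differentiable ℝ (H k) := by
    intro k x
    by_cases hx : x = 0
    · have hxs : ‖x‖ < s := by simpa [hx] using hs
      exact (differentiableAt_const (0:ℝ)).congr_of_eventuallyEq (hHz k x hxs)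
    · exact (hHd k x hx).1.differentiableAt
  have hTc : ∀ k, Continuous (fun x : E3 => smoothTransition (κ k * (‖x‖ - s))) := fun k =>
    smoothTransition.continuous.comp (by fun_prop)
  have ia : ∀ k, Integrable (a k) := by
    intro k
    refine integrable_of_vanish _ ((hTc k).continuousOn.mul hdc) ρ s hs ?_ ?_
    · intro x hx; simp only [a, hd0 x hx, mul_zero]
    · intro x hx; simp only [a, H, smoothTransition.zero_of_nonpos (hneg k x hx.le), zero_mul]
  have iH : ∀ k, Integrable (H k) := by
    intro k
    refine integrable_of_vanish _ ((hTc k).continuousOn.mul hGc) ρ s hs ?_ ?_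
    · intro x hx; simp only [H, h0 x hx, mul_zero]
    · intro x hx; simp only [a, H, smoothTransition.zero_of_nonpos (hneg k x hx.le), zero_mul]
  have ib : ∀ k, Integrable (b k) := by
    intro k
    refine integrable_of_vanish _ ?_ ρ s hs ?_ ?_
    · refine ContinuousOn.mul (ContinuousOn.mul ?_ ?_) hGc
      · exact (continuous_const.mul (dT_cont.comp (by fun_prop))).continuousOn
      · refine ContinuousOn.div (by fun_prop) (by fun_prop) ?_
        intro x hx; exact norm_ne_zero_iff.2 hx
    · intro x hx; simp only [b, h0 x hx, mul_zero]
    · intro x hx; simp only [b, dT_nonpos _ (hneg k x hx.le), mul_zero, zero_mul]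
  have hzero : ∀ k, ∫ x, a k x = - ∫ x, b k x := by
    intro k
    have hp : pder i (H k) = fun x => a k x + b k x := funext (hpd k)
    have := integral_pder_eq_zero i (H k) (hdiff k) (iH k) (by rw [hp]; exact (ia k).add (ib k))
    rw [hp, integral_add (ia k) (ib k)] at this
    linarith
  -- limit of the left side
  have hL : Tendsto (fun k => ∫ x, a k x) atTop (𝓝 (∫ x in (Metric.closedBall 0 s)ᶜ, pder i G x)) := by
    rw [← integral_indicator measurableSet_closedBall.compl]
    have hio := (integrableOn_compl_ball (pder i G) hdc ρ s hs hd0).norm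
    refine tendsto_integral_of_dominated_convergence
      ((Metric.ball (0:E3) s)ᶜ.indicator (fun x => ‖pder i G x‖))
      (fun k => (ia k).aestronglyMeasurable) ?_ ?_ ?_
    · exact (integrable_indicator_iff Metric.isOpen_ball.measurableSet.compl).2 hio
    · intro k
      refine Eventually.of_forall fun x => ?_
      by_cases hx : ‖x‖ < s
      · simp only [a, smoothTransition.zero_of_nonpos (hneg k x hx.le), zero_mul, norm_zero]
        exact Set.indicator_nonneg (fun _ _ => norm_nonneg _) _
      · rw [Set.indicator_of_mem (by simpa using hx)]
        simp only [a, norm_mul]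
        refine mul_le_of_le_one_left (norm_nonneg _) ?_
        rw [Real.norm_of_nonneg (smoothTransition.nonneg _)]
        exact smoothTransition.le_one _
    · refine Eventually.of_forall fun x => ?_
      by_cases hx : ‖x‖ ≤ s
      · rw [Set.indicator_of_notMem (by simpa using hx)]
        simp only [a, smoothTransition.zero_of_nonpos (hneg _ x hx), zero_mul]
        exact tendsto_const_nhds
      · rw [Set.indicator_of_mem (by simpa using hx)]
        push Not at hx
        have ht : Tendsto (fun k => κ k * (‖x‖ - s)) atTop atTop :=
          (tendsto_natCast_atTop_atTop.comp (tendsto_add_atTop_nat 1)).atTop_mul_const (by linarith)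
        refine tendsto_const_nhds.congr' ?_
        filter_upwards [ht.eventually_ge_atTop 1] with k hk
        simp only [a, smoothTransition.one_of_one_le hk, one_mul]
  have hR : Tendsto (fun k => ∫ x, b k x) atTop
      (𝓝 (s ^ 2 * ∫ n : S2, (n : E3) i * G (s • (n : E3)) ∂dOmega)) := by
    have hφ : ContinuousOn (fun r : ℝ => r ^ 2 * ∫ n : S2, (n : E3) i * G (r • (n : E3)) ∂dOmega)
        (Set.Ioi 0) := by
      refine ContinuousOn.mul (by fun_prop) ?_
      exact continuousOn_sphInt (fun n : S2 => (n : E3) i) (by fun_prop) G hGc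
    refine (approx_id _ hφ s hs).congr fun k => ?_
    rw [polar_integral _ (ib k)]
    refine setIntegral_congr_fun measurableSet_Ioi fun r hr => ?_
    have hr : 0 < r := hr
    simp only [b, sphere_norm_smul r hr]
    have : ∀ n : S2, (r • (n : E3)) i / r = (n : E3) i := by
      intro n; simp [hr.ne']
    simp only [this]
    simp only [mul_assoc]
    rw [integral_const_mul, integral_const_mul]
    simp only [κ]
    ring
  have := tendsto_nhds_unique hL (hR.neg.congr fun k => (hzero k).symm)
  exact this


lemma tendsto_rpow_zero (b : ℝ) (hb : 0 < b) : Tendsto (fun s : ℝ => s ^ b) (𝓝[>] 0) (𝓝 0) := by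
  have := (Real.continuousAt_rpow_const 0 b (Or.inr hb.le)).tendsto
  rw [Real.zero_rpow hb.ne'] at this
  exact this.mono_left nhdsWithin_le_nhds

lemma matching_indexed {ι : Type} (J : Finset ι) (α k : ι → ℝ) (κ M : ℝ) (hJ : ∀ j ∈ J, α j < 0)
    (h : Tendsto (fun s : ℝ => ∑ j ∈ J, k j * s ^ α j + κ * Real.log s) (𝓝[>] 0) (𝓝 M)) :
    κ = 0 ∧ M = 0 := by
  classical
  refine matching (J.image α) (fun b => ∑ j ∈ J with α j = b, k j) κ M ?_ (h.congr fun s => ?_)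
  · intro a ha
    obtain ⟨j, hj, rfl⟩ := Finset.mem_image.1 ha
    exact hJ j hj
  · congr 1
    rw [← Finset.sum_fiberwise_of_maps_to (g := α) (t := J.image α)
      (fun j hj => Finset.mem_image_of_mem _ hj)]
    refine Finset.sum_congr rfl fun b _ => ?_
    rw [Finset.sum_mul]
    refine Finset.sum_congr rfl fun j hj => ?_
    rw [(Finset.mem_filter.1 hj).2]

lemma finsum_exponents (c : ℝ → S2 → ℝ) (hfin : {a : ℝ | a ≤ 0 ∧ c a ≠ 0}.Finite)
    (p : ℝ → Prop) [DecidablePred p] (hp : ∀ a, p a → a ≤ 0) (f : ℝ → ℝ)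
    (hf : ∀ a, c a = 0 → f a = 0) :
    ∑ᶠ (a : ℝ) (_ : p a), f a = ∑ a ∈ hfin.toFinset with p a, f a := by
  refine finsum_mem_eq_sum_of_inter_support_eq (s := {a : ℝ | p a}) _ ?_
  ext a
  simp only [Set.mem_inter_iff, Set.mem_ofPred_eq, Function.mem_support, Finset.mem_coe,
    Set.Finite.mem_toFinset, Finset.mem_filter]
  constructor
  · rintro ⟨h1, h2⟩
    exact ⟨⟨⟨hp a h1, fun h => h2 (hf a h)⟩, h1⟩, h2⟩
  · rintro ⟨⟨_, h1⟩, h2⟩; exact ⟨h1, h2⟩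

/-- existence of the one-dimensional partie finie -/
lemma exists_pf_radial (S : Finset ℝ) (C : ℝ → ℝ) (hC : (-3) ∉ S → C (-3) = 0) (I : ℝ → ℝ)
    (hI : ContinuousOn I (Set.Ioi 0)) (ρ : ℝ) (hρ : 0 < ρ) (h0 : ∀ r, ρ < r → I r = 0)
    (he : Tendsto (fun r : ℝ => I r - ∑ a ∈ S, r ^ a * C a) (𝓝[>] 0) (𝓝 0)) (s₁ : ℝ) (hs₁ : 0 < s₁) :
    ∃ P, Tendsto (fun s : ℝ => (∫ r in Set.Ioi s, r ^ 2 * I r)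
      + ∑ a ∈ S with a < -3, s ^ (a + 3) / (a + 3) * C a
      + Real.log (s / s₁) * C (-3)) (𝓝[>] 0) (𝓝 P) := by
  classical
  set e : ℝ → ℝ := fun r => I r - ∑ a ∈ S, r ^ a * C a with hedef
  have hrpow : ∀ a : ℝ, ContinuousOn (fun r : ℝ => r ^ a) (Set.Ioi 0) := fun a r hr =>
    (Real.continuousAt_rpow_const r a (Or.inl (ne_of_gt hr))).continuousWithinAt
  have hecont : ContinuousOn e (Set.Ioi 0) := by
    refine hI.sub (continuousOn_finsetSum _ fun a _ => (hrpow a).mul continuousOn_const)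
  set R : ℝ → ℝ := fun r => ∑ a ∈ S with -3 < a, r ^ (a + 2) * C a + r ^ 2 * e r with hR
  have hdecomp : ∀ r : ℝ, 0 < r → r ^ 2 * I r =
      ∑ a ∈ S with a < -3, r ^ (a + 2) * C a + r⁻¹ * C (-3) + R r := by
    intro r hr
    have h1 : r ^ 2 * I r = ∑ a ∈ S, r ^ (a + 2) * C a + r ^ 2 * e r := by
      simp only [hedef, mul_sub, Finset.mul_sum]
      have : ∀ a, r ^ (a + 2) * C a = r ^ 2 * (r ^ a * C a) := by
        intro a
        rw [Real.rpow_add hr]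
        norm_cast
        ring
      simp only [this]; ring
    have h2 : ∑ a ∈ S, r ^ (a + 2) * C a = ∑ a ∈ S with a < -3, r ^ (a + 2) * C a
        + r⁻¹ * C (-3) + ∑ a ∈ S with -3 < a, r ^ (a + 2) * C a := by
      have h3 : ∑ a ∈ S with a = -3, r ^ (a + 2) * C a = r⁻¹ * C (-3) := by
        rw [Finset.sum_filter, Finset.sum_ite_eq']
        split_ifs with h
        · norm_num [Real.rpow_neg_one]
        · rw [hC h]; simp
      rw [← h3]
      simp only [Finset.sum_filter]
      rw [← Finset.sum_add_distrib, ← Finset.sum_add_distrib]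
      refine Finset.sum_congr rfl fun a _ => ?_
      rcases lt_trichotomy a (-3) with h | h | h
      · simp [h, h.ne, not_lt.2 h.le]
      · simp [h]
      · simp [h, h.ne', not_lt.2 h.le]
    rw [h1, h2, hR]; ring
  -- integrability of R
  have hRint : IntervalIntegrable R volume 0 ρ := by
    refine IntervalIntegrable.add ?_ ?_
    · have : IntervalIntegrable (∑ a ∈ S with -3 < a, fun r : ℝ => r ^ (a + 2) * C a) volume 0 ρ := by
        refine IntervalIntegrable.sum _ fun a ha => ?_
        have := (Finset.mem_filter.1 ha).2
        exact (intervalIntegral.intervalIntegrable_rpow' (by linarith)).mul_const _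
      convert this using 1
      ext r; simp
    · refine ContinuousOn.intervalIntegrable ?_
      rw [Set.uIcc_of_le hρ.le]
      intro r hr
      rcases hr.1.eq_or_lt with h | h
      · subst h
        have h1 : ContinuousWithinAt (fun r : ℝ => r ^ 2 * e r) (Set.Ioi 0) 0 := by
          have h2 : Tendsto (fun r : ℝ => r ^ 2) (𝓝[>] 0) (𝓝 0) := by
            have : Tendsto (fun r : ℝ => r ^ 2) (𝓝 0) (𝓝 (0 ^ 2)) := (continuous_pow 2).tendsto 0
            simp only [ne_eq, OfNat.ofNat_ne_zero, not_false_eq_true, zero_pow] at this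
            exact this.mono_left nhdsWithin_le_nhds
          have h3 := h2.mul he
          unfold ContinuousWithinAt
          simpa using h3
        rw [continuousWithinAt_Ioi_iff_Ici] at h1
        exact h1.mono Set.Icc_subset_Ici_self
      · have : ContinuousOn (fun r : ℝ => r ^ 2 * e r) (Set.Ioi 0) :=
          ContinuousOn.mul (by fun_prop) hecont
        exact (this.continuousAt (Ioi_mem_nhds h)).continuousWithinAt
  have hlim : Tendsto (fun s => ∫ r in s..ρ, R r) (𝓝[>] 0) (𝓝 (∫ r in (0:ℝ)..ρ, R r)) := by
    have h1 : IntegrableOn R (Set.uIcc 0 ρ) := by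
      rw [Set.uIcc_of_le hρ.le, integrableOn_Icc_iff_integrableOn_Ioc]
      exact (intervalIntegrable_iff_integrableOn_Ioc_of_le hρ.le).1 hRint
    have h2 := intervalIntegral.continuousOn_primitive_interval_left h1
    have h3 := h2 0 Set.left_mem_uIcc
    refine h3.tendsto.mono_left ?_
    rw [Set.uIcc_of_le hρ.le]
    exact nhdsWithin_le_of_mem (Filter.mem_of_superset (Ioo_mem_nhdsGT hρ) Set.Ioo_subset_Icc_self)
  refine ⟨∑ a ∈ S with a < -3, ρ ^ (a + 3) / (a + 3) * C a + Real.log (ρ / s₁) * C (-3)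
    + ∫ r in (0:ℝ)..ρ, R r, ?_⟩
  refine (hlim.const_add _).congr' ?_
  filter_upwards [Ioo_mem_nhdsGT hρ] with s hs
  have hs0 := hs.1
  have hsρ := hs.2
  have e1 : ∫ r in Set.Ioi s, r ^ 2 * I r = ∫ r in s..ρ, r ^ 2 * I r := by
    rw [intervalIntegral.integral_of_le hsρ.le]
    refine setIntegral_eq_of_subset_of_forall_sdiff_eq_zero measurableSet_Ioi
      (fun r hr => hr.1) ?_
    rintro r ⟨hr1, hr2⟩
    have : ρ < r := by
      by_contra h
      exact hr2 ⟨hr1, not_lt.1 h⟩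
    rw [h0 r this, mul_zero]
  have hpos : ∀ r ∈ Set.uIcc s ρ, 0 < r := by
    intro r hr
    rw [Set.uIcc_of_le hsρ.le] at hr
    exact hs0.trans_le hr.1
  have hn0 : (0:ℝ) ∉ Set.uIcc s ρ := fun h => lt_irrefl _ (hpos 0 h)
  have e2 : ∫ r in s..ρ, r ^ 2 * I r = 
      ∫ r in s..ρ, (∑ a ∈ S with a < -3, r ^ (a + 2) * C a + r⁻¹ * C (-3) + R r) :=
    intervalIntegral.integral_congr fun r hr => hdecomp r (hpos r hr)
  have i1 : ∀ a : ℝ, IntervalIntegrable (fun r : ℝ => r ^ (a+2) * C a) volume s ρ := fun a =>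
    (ContinuousOn.intervalIntegrable ((hrpow _).mono hpos)).mul_const _
  have i2 : IntervalIntegrable (fun r : ℝ => r⁻¹ * C (-3)) volume s ρ :=
    (ContinuousOn.intervalIntegrable
      (continuousOn_inv₀.mono fun r hr => (hpos r hr).ne')).mul_const _
  have i3 : IntervalIntegrable R volume s ρ := hRint.mono_set (by
    rw [Set.uIcc_of_le hsρ.le, Set.uIcc_of_le hρ.le]; exact Set.Icc_subset_Icc_left hs0.le)
  have i4 : IntervalIntegrable (fun r : ℝ => ∑ a ∈ S with a < -3, r ^ (a + 2) * C a) volume s ρ := by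
    have := IntervalIntegrable.sum (μ := volume) (a := s) (b := ρ) (S.filter (· < -3))
      (f := fun a r => r ^ (a + 2) * C a) (fun a _ => i1 a)
    have heq : (fun r : ℝ => ∑ a ∈ S with a < -3, r ^ (a + 2) * C a)
        = ∑ a ∈ S with a < -3, fun r : ℝ => r ^ (a + 2) * C a := by ext r; simp
    rw [heq]; exact this
  rw [e1, e2, intervalIntegral.integral_add (i4.add i2) i3, intervalIntegral.integral_add i4 i2,
    intervalIntegral.integral_finsetSum (fun a _ => i1 a), intervalIntegral.integral_mul_const,
    integral_inv_of_pos hs0 hρ]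
  have e3 : ∑ a ∈ S with a < -3, ∫ r in s..ρ, r ^ (a + 2) * C a
      = ∑ a ∈ S with a < -3, (ρ ^ (a + 3) / (a + 3) * C a - s ^ (a + 3) / (a + 3) * C a) := by
    refine Finset.sum_congr rfl fun a ha => ?_
    have ha := (Finset.mem_filter.1 ha).2
    rw [intervalIntegral.integral_mul_const, integral_rpow (Or.inr ⟨by linarith, hn0⟩)]
    have : a + 2 + 1 = a + 3 := by ring
    rw [this]; ring
  rw [e3, Finset.sum_sub_distrib, Real.log_div hρ.ne' hs0.ne', Real.log_div hs0.ne' hs₁.ne',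
    Real.log_div hρ.ne' hs₁.ne']
  ring

lemma out_polar (g : E3 → ℝ) (hg : ContinuousOn g {0}ᶜ) (ρ : ℝ) (h0 : ∀ x, ρ < ‖x‖ → g x = 0)
    (s : ℝ) (hs : 0 < s) :
    ∫ x in (Metric.closedBall 0 s)ᶜ, g x
      = ∫ r in Set.Ioi s, r ^ 2 * ∫ n : S2, 1 * g (r • (n : E3)) ∂dOmega := by
  have hsub : (Metric.closedBall (0:E3) s)ᶜ ⊆ (Metric.ball 0 s)ᶜ :=
    Set.compl_subset_compl.2 Metric.ball_subset_closedBall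
  have hi := (integrableOn_compl_ball g hg ρ s hs h0).mono_set hsub
  rw [← integral_indicator measurableSet_closedBall.compl,
    polar_integral _ ((integrable_indicator_iff measurableSet_closedBall.compl).2 hi),
    setIntegral_eq_of_subset_of_forall_sdiff_eq_zero measurableSet_Ioi
      (Set.Ioi_subset_Ioi hs.le)]
  · refine setIntegral_congr_fun measurableSet_Ioi fun r hr => ?_
    have hr : s < r := hr
    have : ∀ n : S2, r • (n : E3) ∈ (Metric.closedBall (0:E3) s)ᶜ := by
      intro n
      simp only [Set.mem_compl_iff, Metric.mem_closedBall, dist_zero_right,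
        sphere_norm_smul r (hs.trans hr), not_le]
      exact hr
    simp only [this, Set.indicator_of_mem, one_mul]
  · rintro r ⟨hr, hr2⟩
    have hr : 0 < r := hr
    have hr2 : r ≤ s := not_lt.1 hr2
    have : ∀ n : S2, r • (n : E3) ∉ (Metric.closedBall (0:E3) s)ᶜ := by
      intro n
      simp only [Set.mem_compl_iff, Metric.mem_closedBall, dist_zero_right,
        sphere_norm_smul r hr, not_not]
      exact hr2
    simp only [this, not_false_eq_true, Set.indicator_of_notMem, integral_zero, mul_zero]

lemma one_point0 (i : Fin 3) (G : E3 → ℝ) (hG : ContDiffOn ℝ (⊤ : ℕ∞) G {0}ᶜ) (ρ : ℝ)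
    (h0 : ∀ x, ρ < ‖x‖ → G x = 0) (c c' : ℝ → S2 → ℝ) (hci : IntegerExponents c)
    (hc : HasSingExpansion 0 G c) (hc' : HasSingExpansion 0 (pder i G) c')
    (s₁ : ℝ) (hs₁ : 0 < s₁) :
    Tendsto (fun s : ℝ => (∫ x in (Metric.closedBall 0 s)ᶜ, pder i G x)
        + (∑ᶠ (a : ℝ) (_ : a ≤ -3), s ^ (a + 2) * ∫ n : S2, (n : E3) i * c a n ∂dOmega))
      (𝓝[>] 0) (𝓝 (-(∫ n : S2, (n : E3) i * c (-2) n ∂dOmega))) ∧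
    Tendsto (fun s : ℝ => (∫ x in (Metric.closedBall 0 s)ᶜ, pder i G x)
        + (∑ᶠ (a : ℝ) (_ : a < -3), s ^ (a + 3) / (a + 3) * ∫ n : S2, c' a n ∂dOmega)
        + Real.log (s / s₁) * (∫ n : S2, c' (-3) n ∂dOmega))
      (𝓝[>] 0) (𝓝 (-(∫ n : S2, (n : E3) i * c (-2) n ∂dOmega))) := by
  classical
  wlog hρ : 0 < ρ generalizing ρ
  · exact this 1 (fun x hx => h0 x (by linarith)) one_pos
  have hop : IsOpen ({0}ᶜ : Set E3) := isOpen_compl_singleton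
  have hdc := pder_continuousOn i G _ hop hG
  have hd0 := pder_zero_of_far i G ρ h0
  set A : ℝ → ℝ := fun a => ∫ n : S2, (n : E3) i * c a n ∂dOmega with hA
  set C : ℝ → ℝ := fun a => ∫ n : S2, c' a n ∂dOmega with hCdef
  have hA0 : ∀ a, c a = 0 → A a = 0 := fun a h => by simp [hA, h]
  have hC0 : ∀ a, c' a = 0 → C a = 0 := fun a h => by simp [hCdef, h]
  set S := (hc.finite_exponents 0).toFinset with hS
  set S' := (hc'.finite_exponents 0).toFinset with hS'
  have f1 : ∀ s : ℝ, ∑ᶠ (a : ℝ) (_ : a ≤ -3), s ^ (a + 2) * A a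
      = ∑ a ∈ S with a ≤ -3, s ^ (a + 2) * A a := fun s =>
    finsum_exponents c (hc.finite_exponents 0) (· ≤ -3) (fun a h => by linarith) _
      (fun a h => by rw [hA0 a h, mul_zero])
  have f2 : ∀ s : ℝ, ∑ᶠ (a : ℝ) (_ : a < -3), s ^ (a + 3) / (a + 3) * C a
      = ∑ a ∈ S' with a < -3, s ^ (a + 3) / (a + 3) * C a := fun s =>
    finsum_exponents c' (hc'.finite_exponents 0) (· < -3) (fun a h => by linarith) _
      (fun a h => by rw [hC0 a h, mul_zero])
  have partA : Tendsto (fun s : ℝ => (∫ x in (Metric.closedBall 0 s)ᶜ, pder i G x)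
        + (∑ᶠ (a : ℝ) (_ : a ≤ -3), s ^ (a + 2) * A a)) (𝓝[>] 0) (𝓝 (-A (-2))) := by
    have he := expansion_int G c hc hG.continuousOn (fun n : S2 => (n : E3) i) (by fun_prop)
    have h2 : Tendsto (fun r : ℝ => r ^ 2) (𝓝[>] 0) (𝓝 0) := by
      have : Tendsto (fun r : ℝ => r ^ 2) (𝓝 0) (𝓝 (0 ^ 2)) := (continuous_pow 2).tendsto 0
      simp only [ne_eq, OfNat.ofNat_ne_zero, not_false_eq_true, zero_pow] at this
      exact this.mono_left nhdsWithin_le_nhds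
    have h3 : Tendsto (fun s : ℝ => ∑ a ∈ S with ¬ a ≤ -3, s ^ (a + 2) * A a) (𝓝[>] 0)
        (𝓝 (∑ a ∈ S with ¬ a ≤ -3, if a = -2 then A a else 0)) := by
      refine tendsto_finsetSum _ fun a ha => ?_
      obtain ⟨ha1, ha2⟩ := Finset.mem_filter.1 ha
      have hne : c a ≠ 0 := ((hc.finite_exponents 0).mem_toFinset.1 ha1).2
      obtain ⟨k, hk⟩ := hci a hne
      split_ifs with h
      · subst h
        simp only [neg_add_cancel, rpow_zero, one_mul]
        exact tendsto_const_nhds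
      · have hk3 : -3 < k := by
          have : (-3 : ℝ) < k := by rw [← hk]; exact not_le.1 ha2
          exact_mod_cast this
        have hk2 : k ≠ -2 := by
          rintro rfl; exact h (by rw [hk]; norm_num)
        have hk4 : -1 ≤ k := by omega
        have : (-1 : ℝ) ≤ a := by rw [hk]; exact_mod_cast hk4
        simpa using (tendsto_rpow_zero (a + 2) (by linarith)).mul_const (A a)
    have h4 : (∑ a ∈ S with ¬ a ≤ -3, if a = -2 then A a else 0) = A (-2) := by
      rw [Finset.sum_ite_eq']
      split_ifs with h
      · rfl
      · symm
        apply hA0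
        by_contra hne
        refine h (Finset.mem_filter.2 ⟨(hc.finite_exponents 0).mem_toFinset.2 ⟨by norm_num, hne⟩, by norm_num⟩)
    rw [h4] at h3
    have h5 := (h3.add (h2.mul he)).neg
    simp only [mul_zero, add_zero] at h5
    refine h5.congr' ?_
    filter_upwards [self_mem_nhdsWithin] with s hs
    have hs : 0 < s := hs
    rw [flux i G hG ρ h0 s hs, f1]
    have h6 : ∑ a ∈ S with a ≤ -3, s ^ (a + 2) * A a + ∑ a ∈ S with ¬ a ≤ -3, s ^ (a + 2) * A a
      = s ^ 2 * ∑ a ∈ S, s ^ a * A a := by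
      rw [Finset.sum_filter_add_sum_filter_not, Finset.mul_sum]
      refine Finset.sum_congr rfl fun a _ => ?_
      rw [Real.rpow_add hs]
      norm_cast
      ring
    rw [mul_sub, ← h6]
    ring
  refine ⟨partA, ?_⟩
  have hexp := expansion_int (pder i G) c' hc' hdc (fun _ : S2 => (1:ℝ)) continuous_const
  have hcont := continuousOn_sphInt (fun _ : S2 => (1:ℝ)) continuous_const (pder i G) hdc
  have q1 : (-3 : ℝ) ∉ S' → C (-3) = 0 := by
    intro h
    apply hC0
    by_contra hne
    exact h ((hc'.finite_exponents 0).mem_toFinset.2 ⟨by norm_num, hne⟩)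
  have q2 : ∀ r, ρ < r → ∫ n : S2, 1 * pder i G (r • (n : E3)) ∂dOmega = 0 := by
    intro r hr
    have : ∀ n : S2, pder i G (r • (n : E3)) = 0 := fun n =>
      hd0 _ (by rw [sphere_norm_smul r (hρ.trans hr)]; exact hr)
    simp [this]
  obtain ⟨P, hP⟩ := exists_pf_radial S' C q1 _ hcont ρ hρ q2 (by simpa only [one_mul] using hexp) s₁ hs₁
  have hP' : Tendsto (fun s : ℝ => (∫ x in (Metric.closedBall 0 s)ᶜ, pder i G x)
        + (∑ᶠ (a : ℝ) (_ : a < -3), s ^ (a + 3) / (a + 3) * C a)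
        + Real.log (s / s₁) * C (-3)) (𝓝[>] 0) (𝓝 P) := by
    refine hP.congr' ?_
    filter_upwards [self_mem_nhdsWithin] with s hs
    rw [out_polar (pder i G) hdc ρ hd0 s hs, f2]
  have hdiff := (hP'.sub partA).add_const (Real.log s₁ * C (-3))
  have hm := matching_indexed ((S'.filter (· < -3)).disjSum (S.filter (· ≤ -3)))
    (Sum.elim (fun a => a + 3) (fun a => a + 2))
    (Sum.elim (fun a => C a / (a + 3)) (fun a => - A a)) (C (-3))
    (P - -A (-2) + Real.log s₁ * C (-3)) ?_ (hdiff.congr' ?_)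
  · obtain ⟨h1, h2⟩ := hm
    rw [h1] at h2
    have : P = -A (-2) := by linarith
    rw [← this]; exact hP'
  · intro j hj
    rcases Finset.mem_disjSum.1 hj with ⟨a, ha, rfl⟩ | ⟨a, ha, rfl⟩
    · have := (Finset.mem_filter.1 ha).2
      simp only [Sum.elim_inl]; linarith
    · have := (Finset.mem_filter.1 ha).2
      simp only [Sum.elim_inr]; linarith
  · filter_upwards [self_mem_nhdsWithin] with s hs
    have hs : 0 < s := hs
    rw [Finset.sum_disjSum, f1, f2, Real.log_div hs.ne' hs₁.ne']
    simp only [Sum.elim_inl, Sum.elim_inr]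
    have g1 : ∑ a ∈ S' with a < -3, C a / (a + 3) * s ^ (a + 3)
      = ∑ a ∈ S' with a < -3, s ^ (a + 3) / (a + 3) * C a :=
      Finset.sum_congr rfl fun a _ => by ring
    have g2 : ∑ a ∈ S with a ≤ -3, -A a * s ^ (a + 2)
      = - ∑ a ∈ S with a ≤ -3, s ^ (a + 2) * A a := by
      rw [← Finset.sum_neg_distrib]
      exact Finset.sum_congr rfl fun a _ => by ring
    rw [g1, g2]; ring


lemma decay_zero (i : Fin 3) (G : E3 → ℝ) (hG : ContDiff ℝ (⊤ : ℕ∞) G)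
    (hdecay : Tendsto (fun x : E3 => ‖x‖ ^ 2 * G x) (cocompact E3) (𝓝 0))
    (hint : Integrable (pder i G)) : ∫ x, pder i G x = 0 := by
  let R : ℕ → ℝ := fun k => ((k+1 : ℕ) : ℝ)
  have hR : ∀ k, 0 < R k := fun k => by simp only [R]; positivity
  have hRt : Tendsto R atTop atTop := tendsto_natCast_atTop_atTop.comp (tendsto_add_atTop_nat 1)
  let w : ℕ → E3 → ℝ := fun k x => 2 - (R k ^ 2)⁻¹ * ‖x‖ ^ 2
  let a : ℕ → E3 → ℝ := fun k x => smoothTransition (w k x) * pder i G x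
  let b : ℕ → E3 → ℝ := fun k x =>
    deriv smoothTransition (w k x) * (-((R k ^ 2)⁻¹ * (2 * x i))) * G x
  let H : ℕ → E3 → ℝ := fun k x => smoothTransition (w k x) * G x
  have hwsmall : ∀ k x, ‖x‖ ≤ R k → 1 ≤ w k x := by
    intro k x hx
    have : (R k ^ 2)⁻¹ * ‖x‖ ^ 2 ≤ 1 := by
      rw [inv_mul_le_iff₀ (by have := hR k; positivity), mul_one]
      exact pow_le_pow_left₀ (norm_nonneg _) hx 2
    simp only [w]; linarith
  have hwbig : ∀ k x, 2 * R k ≤ ‖x‖ → w k x ≤ 0 := by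
    intro k x hx
    have hk := hR k
    have : 2 ≤ (R k ^ 2)⁻¹ * ‖x‖ ^ 2 := by
      rw [le_inv_mul_iff₀ (by positivity)]
      nlinarith
    simp only [w]; linarith
  have hwc : ∀ k, Continuous (w k) := fun k => by simp only [w]; fun_prop
  have hGd : Differentiable ℝ G := hG.differentiable (by simp)
  have hpc : Continuous (pder i G) := by
    have := pder_continuousOn i G Set.univ isOpen_univ hG.contDiffOn
    simpa [continuousOn_univ] using this
  have hHd : ∀ k x, HasFDerivAt (H k) (fderiv ℝ (H k) x) x ∧ pder i (H k) x = a k x + b k x := by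
    intro k x
    have h1 : HasFDerivAt (w k) _ x :=
      ((hasStrictFDerivAt_norm_sq x).hasFDerivAt.const_mul (R k ^ 2)⁻¹).const_sub 2
    have hT := HasDerivAt.comp_hasFDerivAt (h₂ := smoothTransition) x (T_diff (w k x)).hasDerivAt h1
    have hm := hT.mul (hGd x).hasFDerivAt
    have hm' : HasFDerivAt (H k) _ x := hm
    refine ⟨hm'.differentiableAt.hasFDerivAt, ?_⟩
    rw [pder, hm'.fderiv]
    simp [a, b, pder, EuclideanSpace.inner_single_right]
    ring
  have hcs : ∀ k (f : E3 → ℝ), Continuous f → (∀ x, 2 * R k ≤ ‖x‖ → f x = 0) → Integrable f := by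
    intro k f hf h
    refine hf.integrable_of_hasCompactSupport ?_
    refine HasCompactSupport.intro (isCompact_closedBall (0:E3) (2 * R k)) fun x hx => h x ?_
    simp only [Metric.mem_closedBall, dist_zero_right, not_le] at hx
    exact hx.le
  have ia : ∀ k, Integrable (a k) := fun k =>
    hcs k _ ((smoothTransition.continuous.comp (hwc k)).mul hpc) fun x hx => by
      simp only [a, smoothTransition.zero_of_nonpos (hwbig k x hx), zero_mul]
  have iH : ∀ k, Integrable (H k) := fun k =>
    hcs k _ ((smoothTransition.continuous.comp (hwc k)).mul hG.continuous) fun x hx => by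
      simp only [H, smoothTransition.zero_of_nonpos (hwbig k x hx), zero_mul]
  have ib : ∀ k, Integrable (b k) := fun k =>
    hcs k _ (((dT_cont.comp (hwc k)).mul (by fun_prop)).mul hG.continuous) fun x hx => by
      simp only [b, dT_nonpos _ (hwbig k x hx), zero_mul]
  have hzero : ∀ k, ∫ x, a k x = - ∫ x, b k x := by
    intro k
    have hp : pder i (H k) = fun x => a k x + b k x := funext fun x => (hHd k x).2
    have := integral_pder_eq_zero i (H k) (fun x => (hHd k x).1.differentiableAt) (iH k)
      (by rw [hp]; exact (ia k).add (ib k))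
    rw [hp, integral_add (ia k) (ib k)] at this
    linarith
  have hL : Tendsto (fun k => ∫ x, a k x) atTop (𝓝 (∫ x, pder i G x)) := by
    refine tendsto_integral_of_dominated_convergence (fun x => ‖pder i G x‖)
      (fun k => (ia k).aestronglyMeasurable) hint.norm ?_ ?_
    · intro k
      refine Eventually.of_forall fun x => ?_
      simp only [a, norm_mul]
      refine mul_le_of_le_one_left (norm_nonneg _) ?_
      rw [Real.norm_of_nonneg (smoothTransition.nonneg _)]
      exact smoothTransition.le_one _
    · refine Eventually.of_forall fun x => ?_
      refine tendsto_const_nhds.congr' ?_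
      filter_upwards [hRt.eventually_ge_atTop ‖x‖] with k hk
      simp only [a, smoothTransition.one_of_one_le (hwsmall k x hk), one_mul]
  have hb0 : Tendsto (fun k => ∫ x, b k x) atTop (𝓝 0) := by
    obtain ⟨C, hC⟩ := dT_bound
    have hC0 : 0 ≤ C := (abs_nonneg _).trans (hC 0)
    set V := (volume : Measure E3).real (Metric.ball 0 1) with hV
    have hV0 : 0 ≤ V := measureReal_nonneg
    rw [Metric.tendsto_nhds]
    intro ε hε
    set ε' := ε / (16 * C * V + 1) with hε'
    have hε'0 : 0 < ε' := by positivity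
    have hev : ∀ᶠ x in cocompact E3, |‖x‖ ^ 2 * G x| < ε' := by
      have := (Metric.tendsto_nhds.1 hdecay) ε' hε'0
      simpa only [dist_zero_right, Real.norm_eq_abs] using this
    rw [← Metric.cobounded_eq_cocompact, (hasBasis_cobounded_norm (E := E3)).eventually_iff] at hev
    obtain ⟨R0, -, hR0⟩ := hev
    filter_upwards [hRt.eventually_ge_atTop R0] with k hk
    have hRk := hR k
    have hsupp : ∫ x, b k x = ∫ x in Metric.closedBall (0:E3) (2 * R k), b k x := by
      rw [setIntegral_eq_integral_of_forall_compl_eq_zero]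
      intro x hx
      simp only [Metric.mem_closedBall, dist_zero_right, not_le] at hx
      simp only [b, dT_nonpos _ (hwbig k x hx.le), zero_mul]
    have hbd : ∀ x, ‖b k x‖ ≤ 2 * C * ε' / R k ^ 3 := by
      intro x
      rcases le_total ‖x‖ (R k) with h | h
      · simp only [b, dT_one_le _ (hwsmall k x h), zero_mul, norm_zero]
        positivity
      · have hx0 : 0 < ‖x‖ := hRk.trans_le h
        have h1 : |‖x‖ ^ 2 * G x| < ε' := hR0 (by simpa using hk.trans h)
        rw [abs_mul, abs_of_nonneg (by positivity)] at h1
        have h2 : |x i| ≤ ‖x‖ := by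
          simpa using PiLp.norm_apply_le x i
        simp only [b, norm_mul, norm_neg, norm_inv, norm_pow, Real.norm_eq_abs, abs_of_pos hRk, abs_two]
        have h3 : |G x| ≤ ε' / ‖x‖ ^ 2 := by
          rw [le_div_iff₀ (by positivity)]; linarith
        calc |deriv smoothTransition (w k x)| * ((R k ^ 2)⁻¹ * (2 * |x i|)) * |G x|
            ≤ C * ((R k ^ 2)⁻¹ * (2 * ‖x‖)) * (ε' / ‖x‖ ^ 2) := by
              gcongr
              exact hC _
          _ = 2 * C * ε' / (R k ^ 2 * ‖x‖) := by field_simp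
          _ ≤ 2 * C * ε' / R k ^ 3 := by
              have h4 : R k ^ 3 ≤ R k ^ 2 * ‖x‖ := by
                calc R k ^ 3 = R k ^ 2 * R k := by ring
                  _ ≤ _ := by gcongr
              exact div_le_div_of_nonneg_left (by positivity) (by positivity) h4
    rw [dist_zero_right, hsupp]
    refine (norm_setIntegral_le_of_norm_le_const (isCompact_closedBall _ _).measure_lt_top
      (fun x _ => hbd x)).trans_lt ?_
    rw [Measure.addHaar_real_closedBall _ _ (by positivity), ← hV]
    have : Module.finrank ℝ E3 = 3 := by simp
    rw [this]
    have e : 2 * C * ε' / R k ^ 3 * ((2 * R k) ^ 3 * V) = 16 * C * V * ε' := by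
      field_simp; ring
    rw [e, hε', mul_div_assoc', div_lt_iff₀ (by positivity)]
    nlinarith
  have h2 := hb0.neg.congr fun k => (hzero k).symm
  rw [neg_zero] at h2
  exact tendsto_nhds_unique hL h2

lemma HasSingExpansion.congr_ball {y y' : E3} {F F' : E3 → ℝ} {c : ℝ → S2 → ℝ}
    (h : HasSingExpansion y F c) (δ₀ : ℝ) (hδ₀ : 0 < δ₀)
    (hF : ∀ z : E3, ‖z‖ < δ₀ → F' (y' + z) = F (y + z)) : HasSingExpansion y' F' c where
  smooth_coeffs := h.smooth_coeffs
  bddBelow := h.bddBelow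
  finite_exponents := h.finite_exponents
  expansion := by
    intro N ε hε
    obtain ⟨δ, hδ, h'⟩ := h.expansion N ε hε
    refine ⟨min δ δ₀, lt_min hδ hδ₀, fun r hr hr' n => ?_⟩
    rw [hF _ (by rw [sphere_norm_smul r hr]; exact hr'.trans_le (min_le_right _ _))]
    exact h' r hr (hr'.trans_le (min_le_left _ _)) n

lemma pder_translate (i : Fin 3) (G : E3 → ℝ) (y x : E3) :
    pder i (fun z => G (y + z)) x = pder i G (y + x) := by
  simp only [pder]
  rw [fderiv_comp_add_left]

lemma setIntegral_translate (g : E3 → ℝ) (y : E3) (s : ℝ) :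
    ∫ x in (Metric.closedBall y s)ᶜ, g x = ∫ x in (Metric.closedBall 0 s)ᶜ, g (y + x) := by
  rw [← integral_indicator measurableSet_closedBall.compl,
    ← integral_indicator measurableSet_closedBall.compl,
    ← integral_add_left_eq_self _ y]
  congr 1
  ext x
  simp [Set.indicator, dist_eq_norm]

/-- The one point result at a general centre. -/
lemma one_point (y : E3) (i : Fin 3) (G : E3 → ℝ) (hG : ContDiffOn ℝ (⊤ : ℕ∞) G {y}ᶜ) (ρ : ℝ)
    (h0 : ∀ x, ρ < ‖x - y‖ → G x = 0) (c c' : ℝ → S2 → ℝ) (hci : IntegerExponents c)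
    (hc : HasSingExpansion y G c) (hc' : HasSingExpansion y (pder i G) c')
    (s₁ : ℝ) (hs₁ : 0 < s₁) :
    (∀ s, 0 < s → IntegrableOn (pder i G) (Metric.closedBall y s)ᶜ) ∧
    Tendsto (fun s : ℝ => (∫ x in (Metric.closedBall y s)ᶜ, pder i G x)
        + (∑ᶠ (a : ℝ) (_ : a ≤ -3), s ^ (a + 2) * ∫ n : S2, (n : E3) i * c a n ∂dOmega))
      (𝓝[>] 0) (𝓝 (-(∫ n : S2, (n : E3) i * c (-2) n ∂dOmega))) ∧
    Tendsto (fun s : ℝ => (∫ x in (Metric.closedBall y s)ᶜ, pder i G x)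
        + (∑ᶠ (a : ℝ) (_ : a < -3), s ^ (a + 3) / (a + 3) * ∫ n : S2, c' a n ∂dOmega)
        + Real.log (s / s₁) * (∫ n : S2, c' (-3) n ∂dOmega))
      (𝓝[>] 0) (𝓝 (-(∫ n : S2, (n : E3) i * c (-2) n ∂dOmega))) := by
  have hG' : ContDiffOn ℝ (⊤ : ℕ∞) (fun z => G (y + z)) {0}ᶜ := by
    refine hG.comp (by fun_prop) ?_
    intro x hx
    simpa using hx
  have h0' : ∀ x, ρ < ‖x‖ → G (y + x) = 0 := fun x hx => h0 _ (by simpa using hx)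
  have hp : pder i (fun z => G (y + z)) = fun x => pder i G (y + x) :=
    funext fun x => pder_translate i G y x
  refine ⟨fun s hs => ?_, ?_⟩
  · have hcont := pder_continuousOn i _ _ isOpen_compl_singleton hG'
    have hz := pder_zero_of_far i _ ρ h0'
    have := (integrableOn_compl_ball _ hcont ρ s hs hz).mono_set
      (Set.compl_subset_compl.2 Metric.ball_subset_closedBall)
    rw [hp, ← integrable_indicator_iff measurableSet_closedBall.compl] at this
    rw [← integrable_indicator_iff measurableSet_closedBall.compl]
    have h2 := this.comp_sub_right y
    refine h2.congr (Eventually.of_forall fun x => ?_)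
    simp [Set.indicator, dist_eq_norm]
  · have ht : ∀ s, ∫ x in (Metric.closedBall y s)ᶜ, pder i G x
        = ∫ x in (Metric.closedBall 0 s)ᶜ, pder i G (y + x) :=
      fun s => setIntegral_translate _ y s
    have := one_point0 i (fun z => G (y + z)) hG' ρ h0' c c' hci
      (hc.congr_ball 1 one_pos (by simp)) (hc'.congr_ball 1 one_pos (by simp [hp])) s₁ hs₁
    simp only [hp] at this
    refine ⟨this.1.congr fun s => by rw [ht s], this.2.congr fun s => by rw [ht s]⟩

lemma pder_congr_ball (i : Fin 3) (F G : E3 → ℝ) (U : Set E3) (hU : IsOpen U)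
    (h : ∀ x ∈ U, F x = G x) : ∀ x ∈ U, pder i F x = pder i G x := by
  intro x hx
  have : F =ᶠ[𝓝 x] G := by
    filter_upwards [hU.mem_nhds hx] with z hz using h z hz
  rw [pder, pder, this.fderiv_eq]

/-- Localization near one singular point. -/
lemma localize (y y' : E3) (F : E3 → ℝ) (hF : ContDiffOn ℝ (⊤ : ℕ∞) F ({y, y'}ᶜ : Set E3))
    (D : ℝ) (hD : 0 < D) (hy : D = dist y y') :
    ∃ F₁ : E3 → ℝ, ContDiffOn ℝ (⊤ : ℕ∞) F₁ {y}ᶜ ∧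
      (∀ x ∈ (Metric.closedBall y (D / 3))ᶜ, F₁ x = 0) ∧ (∀ x ∈ Metric.ball y (D/4), F₁ x = F x) := by
  let η : ContDiffBump y := ⟨D/4, D/3, by positivity, by linarith⟩
  have hz : ∀ x ∈ (Metric.closedBall y (D / 3))ᶜ, η x * F x = 0 := by
    intro x hx
    rw [η.zero_of_le_dist, zero_mul]
    simp only [Set.mem_compl_iff, Metric.mem_closedBall, not_le] at hx
    exact hx.le
  refine ⟨fun x => η x * F x, ?_, hz, ?_⟩
  · intro x hx
    refine ContDiffAt.contDiffWithinAt ?_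
    by_cases h : x = y'
    · refine (contDiffAt_const (c := (0:ℝ))).congr_of_eventuallyEq ?_
      have : x ∈ (Metric.closedBall y (D / 3))ᶜ := by
        simp only [Set.mem_compl_iff, Metric.mem_closedBall, not_le, h]
        rw [dist_comm, ← hy]; linarith
      filter_upwards [Metric.isClosed_closedBall.isOpen_compl.mem_nhds this] with z hz' using hz z hz'
    · have hop : IsOpen ({y, y'}ᶜ : Set E3) := (Set.toFinite {y, y'}).isClosed.isOpen_compl
      refine η.contDiffAt.mul (hF.contDiffAt (hop.mem_nhds ?_))
      simp only [Set.mem_compl_iff, Set.mem_insert_iff, Set.mem_singleton_iff, not_or]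
      exact ⟨hx, h⟩
  · intro x hx
    have : η x = 1 := η.one_of_mem_closedBall (Metric.ball_subset_closedBall hx)
    simp only [this, one_mul]

lemma split_integral (y₁ y₂ : E3) (hy : y₁ ≠ y₂) 
    (F : E3 → ℝ) (hF : ContDiffOn ℝ (⊤ : ℕ∞) F ({y₁, y₂}ᶜ : Set E3)) (i : Fin 3)
    (hdecay : Tendsto (fun x : E3 => ‖x‖ ^ 2 * F x) (cocompact E3) (𝓝 0))
    (hint : ∃ R : ℝ, IntegrableOn (pder i F) (Metric.closedBall 0 R)ᶜ volume)
    (D : ℝ) (hD : D = dist y₁ y₂) (F₁ F₂ : E3 → ℝ)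
    (h1 : ContDiffOn ℝ (⊤ : ℕ∞) F₁ {y₁}ᶜ) (h2 : ContDiffOn ℝ (⊤ : ℕ∞) F₂ {y₂}ᶜ)
    (z1 : ∀ x ∈ (Metric.closedBall y₁ (D / 3))ᶜ, F₁ x = 0)
    (z2 : ∀ x ∈ (Metric.closedBall y₂ (D / 3))ᶜ, F₂ x = 0)
    (e1 : ∀ x ∈ Metric.ball y₁ (D/4), F₁ x = F x)
    (e2 : ∀ x ∈ Metric.ball y₂ (D/4), F₂ x = F x)
    (i1 : ∀ s, 0 < s → IntegrableOn (pder i F₁) (Metric.closedBall y₁ s)ᶜ)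
    (i2 : ∀ s, 0 < s → IntegrableOn (pder i F₂) (Metric.closedBall y₂ s)ᶜ)
    (s : ℝ) (hs : 0 < s) (hsD : s < D / 4) :
    ∫ x in (Metric.closedBall y₁ s ∪ Metric.closedBall y₂ s)ᶜ, pder i F x
      = (∫ x in (Metric.closedBall y₁ s)ᶜ, pder i F₁ x) + ∫ x in (Metric.closedBall y₂ s)ᶜ, pder i F₂ x := by
  have hDpos : 0 < D := by rw [hD]; exact dist_pos.2 hy
  have hop : IsOpen ({y₁, y₂}ᶜ : Set E3) := (Set.toFinite {y₁, y₂}).isClosed.isOpen_compl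
  have far1 : ∀ x ∈ Metric.ball y₁ (D/4), x ∈ (Metric.closedBall y₂ (D/3))ᶜ := by
    intro x hx
    simp only [Set.mem_compl_iff, Metric.mem_closedBall, not_le, Metric.mem_ball] at hx ⊢
    have := dist_triangle y₁ x y₂
    rw [← hD, dist_comm y₁ x] at this
    linarith
  have far2 : ∀ x ∈ Metric.ball y₂ (D/4), x ∈ (Metric.closedBall y₁ (D/3))ᶜ := by
    intro x hx
    simp only [Set.mem_compl_iff, Metric.mem_closedBall, not_le, Metric.mem_ball] at hx ⊢
    have := dist_triangle y₁ x y₂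
    rw [← hD, dist_comm y₁ x] at this
    linarith
  have oc1 : IsOpen (Metric.closedBall y₁ (D/3))ᶜ := Metric.isClosed_closedBall.isOpen_compl
  have oc2 : IsOpen (Metric.closedBall y₂ (D/3))ᶜ := Metric.isClosed_closedBall.isOpen_compl
  have pz : ∀ x, pder i (fun _ : E3 => (0:ℝ)) x = 0 := fun x => by simp [pder]
  have pz1 : ∀ x ∈ (Metric.closedBall y₁ (D / 3))ᶜ, pder i F₁ x = 0 := fun x hx => by
    rw [pder_congr_ball i F₁ (fun _ => 0) _ oc1 z1 x hx, pz]
  have pz2 : ∀ x ∈ (Metric.closedBall y₂ (D / 3))ᶜ, pder i F₂ x = 0 := fun x hx => by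
    rw [pder_congr_ball i F₂ (fun _ => 0) _ oc2 z2 x hx, pz]
  set F₀ : E3 → ℝ := fun x => F x - F₁ x - F₂ x with hF₀
  have z01 : ∀ x ∈ Metric.ball y₁ (D/4), F₀ x = 0 := fun x hx => by
    simp only [hF₀, e1 x hx, z2 x (far1 x hx)]; ring
  have z02 : ∀ x ∈ Metric.ball y₂ (D/4), F₀ x = 0 := fun x hx => by
    simp only [hF₀, e2 x hx, z1 x (far2 x hx)]; ring
  have pz01 : ∀ x ∈ Metric.ball y₁ (D/4), pder i F₀ x = 0 := fun x hx => by
    rw [pder_congr_ball i F₀ (fun _ => 0) _ Metric.isOpen_ball z01 x hx, pz]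
  have pz02 : ∀ x ∈ Metric.ball y₂ (D/4), pder i F₀ x = 0 := fun x hx => by
    rw [pder_congr_ball i F₀ (fun _ => 0) _ Metric.isOpen_ball z02 x hx, pz]
  have cF : ∀ x, x ≠ y₁ → x ≠ y₂ → ContDiffAt ℝ (⊤ : ℕ∞) F x := fun x hx hx' =>
    hF.contDiffAt (hop.mem_nhds (by simp [hx, hx']))
  have c1 : ∀ x, x ≠ y₁ → ContDiffAt ℝ (⊤ : ℕ∞) F₁ x := fun x hx =>
    h1.contDiffAt (isOpen_compl_singleton.mem_nhds hx)
  have c2 : ∀ x, x ≠ y₂ → ContDiffAt ℝ (⊤ : ℕ∞) F₂ x := fun x hx =>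
    h2.contDiffAt (isOpen_compl_singleton.mem_nhds hx)
  have hc0 : ContDiff ℝ (⊤ : ℕ∞) F₀ := by
    rw [contDiff_iff_contDiffAt]
    intro x
    by_cases hx1 : x = y₁
    · refine (contDiffAt_const (c := (0:ℝ))).congr_of_eventuallyEq ?_
      filter_upwards [Metric.isOpen_ball.mem_nhds (show x ∈ Metric.ball y₁ (D/4) by
        rw [hx1]; exact Metric.mem_ball_self (by positivity))] with z hz using z01 z hz
    by_cases hx2 : x = y₂
    · refine (contDiffAt_const (c := (0:ℝ))).congr_of_eventuallyEq ?_
      filter_upwards [Metric.isOpen_ball.mem_nhds (show x ∈ Metric.ball y₂ (D/4) by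
        rw [hx2]; exact Metric.mem_ball_self (by positivity))] with z hz using z02 z hz
    exact ((cF x hx1 hx2).sub (c1 x hx1)).sub (c2 x hx2)
  have hsum : ∀ x, x ≠ y₁ → x ≠ y₂ → pder i F x = pder i F₁ x + pder i F₂ x + pder i F₀ x := by
    intro x hx1 hx2
    have d := (cF x hx1 hx2).differentiableAt (by simp)
    have d1 := (c1 x hx1).differentiableAt (by simp)
    have d2 := (c2 x hx2).differentiableAt (by simp)
    have := ((d.hasFDerivAt.sub d1.hasFDerivAt).sub d2.hasFDerivAt)
    have h' : HasFDerivAt F₀ _ x := this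
    simp only [pder, h'.fderiv]
    simp
  have agree : ∀ x ∈ (Metric.closedBall y₁ (D/3))ᶜ ∩ (Metric.closedBall y₂ (D/3))ᶜ, F₀ x = F x := by
    rintro x ⟨hx1, hx2⟩
    simp only [hF₀, z1 x hx1, z2 x hx2, sub_zero]
  have pagree := pder_congr_ball i F₀ F _ (oc1.inter oc2) agree
  have hdec0 : Tendsto (fun x : E3 => ‖x‖ ^ 2 * F₀ x) (cocompact E3) (𝓝 0) := by
    refine hdecay.congr' ?_
    filter_upwards [(isCompact_closedBall y₁ (D/3)).compl_mem_cocompact,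
      (isCompact_closedBall y₂ (D/3)).compl_mem_cocompact] with x hx1 hx2
    rw [agree x ⟨hx1, hx2⟩]
  have hpc : Continuous (pder i F₀) := by
    have := pder_continuousOn i F₀ Set.univ isOpen_univ hc0.contDiffOn
    simpa [continuousOn_univ] using this
  have hint0 : Integrable (pder i F₀) := by
    obtain ⟨R, hR⟩ := hint
    set K := Metric.closedBall (0:E3) R ∪ (Metric.closedBall y₁ (D/3) ∪ Metric.closedBall y₂ (D/3)) with hK
    have hKc : IsCompact K := (isCompact_closedBall _ _).union
      ((isCompact_closedBall _ _).union (isCompact_closedBall _ _))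
    rw [← integrableOn_univ, ← Set.union_compl_self K]
    refine (hpc.continuousOn.integrableOn_compact hKc).union ?_
    refine IntegrableOn.congr_fun (hR.mono_set (s := Kᶜ) ?_) ?_ hKc.isClosed.measurableSet.compl
    · exact Set.compl_subset_compl.2 Set.subset_union_left
    · intro x hx
      refine (pagree x ⟨fun h => hx (Or.inr (Or.inl h)), fun h => hx (Or.inr (Or.inr h))⟩).symm
  have hzero := decay_zero i F₀ hc0 hdec0 hint0
  set U := (Metric.closedBall y₁ s ∪ Metric.closedBall y₂ s)ᶜ with hU
  have hUm : MeasurableSet U := (measurableSet_closedBall.union measurableSet_closedBall).compl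
  have sub1 : U ⊆ (Metric.closedBall y₁ s)ᶜ := Set.compl_subset_compl.2 Set.subset_union_left
  have sub2 : U ⊆ (Metric.closedBall y₂ s)ᶜ := Set.compl_subset_compl.2 Set.subset_union_right
  have cb1 : ∀ x ∈ Metric.closedBall y₁ s, x ∈ Metric.ball y₁ (D/4) :=
    fun x hx => Metric.closedBall_subset_ball hsD hx
  have cb2 : ∀ x ∈ Metric.closedBall y₂ s, x ∈ Metric.ball y₂ (D/4) :=
    fun x hx => Metric.closedBall_subset_ball hsD hx
  have E0 : ∫ x in U, pder i F₀ x = 0 := by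
    rw [setIntegral_eq_integral_of_forall_compl_eq_zero, hzero]
    intro x hx
    rcases not_not.1 hx with h | h
    · exact pz01 x (cb1 x h)
    · exact pz02 x (cb2 x h)
  have E1 : ∫ x in (Metric.closedBall y₁ s)ᶜ, pder i F₁ x = ∫ x in U, pder i F₁ x := by
    refine setIntegral_eq_of_subset_of_forall_sdiff_eq_zero measurableSet_closedBall.compl sub1 ?_
    rintro x ⟨hx1, hx2⟩
    rcases not_not.1 hx2 with h | h
    · exact absurd h hx1
    · exact pz1 x (far2 x (cb2 x h))
  have E2 : ∫ x in (Metric.closedBall y₂ s)ᶜ, pder i F₂ x = ∫ x in U, pder i F₂ x := by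
    refine setIntegral_eq_of_subset_of_forall_sdiff_eq_zero measurableSet_closedBall.compl sub2 ?_
    rintro x ⟨hx1, hx2⟩
    rcases not_not.1 hx2 with h | h
    · exact pz2 x (far1 x (cb1 x h))
    · exact absurd h hx1
  have E : ∫ x in U, pder i F x = ∫ x in U, (pder i F₁ x + pder i F₂ x + pder i F₀ x) := by
    refine setIntegral_congr_fun hUm fun x hx => hsum x ?_ ?_
    · rintro rfl; exact sub1 hx (Metric.mem_closedBall_self hs.le)
    · rintro rfl; exact sub2 hx (Metric.mem_closedBall_self hs.le)
  have I1 := (i1 s hs).mono_set sub1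
  have I2 := (i2 s hs).mono_set sub2
  have I12 : IntegrableOn (fun x => pder i F₁ x + pder i F₂ x) U := I1.add I2
  rw [E, integral_add I12 hint0.integrableOn, integral_add I1 I2, E0, E1, E2, add_zero]


/-- partie finie of the integral of a gradient.  The limit of the
truncated integral of `∂_iF`, corrected by the surface-like subtractions,
exists and equals `−∫ nⁱ f₋₂ dΩ − ∫ nⁱ g₋₂ dΩ = −4π(n₁ⁱr₁²F)₁ − 4π(n₂ⁱr₂²F)₂`;
moreover this coincides with the Hadamard partie finie `Pf_{s₁,s₂} ∫ ∂_iF d³x`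
(the logarithmic subtractions vanish). -/
theorem pf_integral_of_gradient
    (y₁ y₂ : E3) (hy : y₁ ≠ y₂) (s₁ s₂ : ℝ) (hs₁ : 0 < s₁) (hs₂ : 0 < s₂)
    (F : E3 → ℝ) (c d : ℝ → S2 → ℝ) (hF : MemF y₁ y₂ F c d)
    (hci : IntegerExponents c) (hdi : IntegerExponents d)
    (i : Fin 3) (c' d' : ℝ → S2 → ℝ)
    (hc' : HasSingExpansion y₁ (pder i F) c')
    (hd' : HasSingExpansion y₂ (pder i F) d')
    (hdecay : Tendsto (fun x : E3 => ‖x‖ ^ 2 * F x) (cocompact E3) (𝓝 0))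
    (hint : ∃ R : ℝ, IntegrableOn (pder i F) (Metric.closedBall 0 R)ᶜ volume) :
    Tendsto
      (fun s : ℝ =>
        (∫ x in (Metric.closedBall y₁ s ∪ Metric.closedBall y₂ s)ᶜ, pder i F x)
          + (∑ᶠ (a : ℝ) (_ : a ≤ -3), s ^ (a + 2) * ∫ n : S2, (n : E3) i * c a n ∂dOmega)
          + (∑ᶠ (b : ℝ) (_ : b ≤ -3), s ^ (b + 2) * ∫ n : S2, (n : E3) i * d b n ∂dOmega))
      (𝓝[>] (0 : ℝ))
      (𝓝 (-(∫ n : S2, (n : E3) i * c (-2) n ∂dOmega)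
            - ∫ n : S2, (n : E3) i * d (-2) n ∂dOmega))
    ∧ HasPfIntegral y₁ y₂ s₁ s₂ (pder i F) c' d'
        (-(∫ n : S2, (n : E3) i * c (-2) n ∂dOmega)
          - ∫ n : S2, (n : E3) i * d (-2) n ∂dOmega) := by
  set D := dist y₁ y₂ with hD
  have hDpos : 0 < D := dist_pos.2 hy
  obtain ⟨F₁, h1, z1, e1⟩ := localize y₁ y₂ F hF.smooth D hDpos hD
  obtain ⟨F₂, h2, z2, e2⟩ := localize y₂ y₁ F (by rw [Set.pair_comm]; exact hF.smooth) D hDpos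
    (by rw [dist_comm])
  have pe1 := pder_congr_ball i F₁ F _ Metric.isOpen_ball e1
  have pe2 := pder_congr_ball i F₂ F _ Metric.isOpen_ball e2
  have hball : ∀ (y z : E3), ‖z‖ < D / 4 → y + z ∈ Metric.ball y (D / 4) := by
    intro y z hz; simpa [dist_eq_norm] using hz
  have hD4 : 0 < D / 4 := by positivity
  obtain ⟨i1, A1, B1⟩ := one_point y₁ i F₁ h1 (D / 3)
    (fun x hx => z1 x (by simpa [dist_eq_norm] using hx)) c c' hci
    (hF.exp₁.congr_ball _ hD4 fun z hz => e1 _ (hball _ z hz))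
    (hc'.congr_ball _ hD4 fun z hz => pe1 _ (hball _ z hz)) s₁ hs₁
  obtain ⟨i2, A2, B2⟩ := one_point y₂ i F₂ h2 (D / 3)
    (fun x hx => z2 x (by simpa [dist_eq_norm] using hx)) d d' hdi
    (hF.exp₂.congr_ball _ hD4 fun z hz => e2 _ (hball _ z hz))
    (hd'.congr_ball _ hD4 fun z hz => pe2 _ (hball _ z hz)) s₂ hs₂
  have hsplit := split_integral y₁ y₂ hy F hF.smooth i hdecay hint D hD F₁ F₂ h1 h2 z1 z2 e1 e2 i1 i2
  constructor
  · rw [sub_eq_add_neg]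
    refine (A1.add A2).congr' ?_
    filter_upwards [Ioo_mem_nhdsGT hD4] with s hs
    rw [hsplit s hs.1 hs.2]
    ring
  · unfold HasPfIntegral
    rw [sub_eq_add_neg]
    refine (B1.add B2).congr' ?_
    filter_upwards [Ioo_mem_nhdsGT hD4] with s hs
    rw [pfApprox, hsplit s hs.1 hs.2]
    ring



end
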